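/- Let d ≥ 1 be an integer, s ∈ (0,1) and R > 0. Let f : ℝ^d → ℝ be continuous, 1-periodic in each coordinate, and satisfy |f(x) − f(y)| ≤ R·‖x − y‖^s for all x, y ∈ ℝ^d (Euclidean norm). Then for every integer M ≥ 1, Σ_{k ∈ ℤ^d \ {−M,…,M}^d} |θ_k(f)|² ≤ C(s)·d·R²·(M+1)^{−2s}, where C(s) = 2^{2s}·3^{−s} / (1 − 2^{−2s}) and θ_k(f) = ∫_{[0,1]^d} f(x)·exp(−i·2π⟨k,x⟩) dx. -/

import Mathlib

open MeasureTheory Real Complex Finset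

noncomputable section

def cube (d : ℕ) : Set (Fin d → ℝ) := Set.Icc 0 1

def phi (d : ℕ) (k : Fin d → ℤ) (x : Fin d → ℝ) : ℂ :=
  Complex.exp (Complex.I * (2 * Real.pi) * ∑ i, (k i : ℂ) * (x i : ℂ))

/-- The `k`-th Fourier coefficient `θ_k(g) = ∫_{[0,1]^d} g(x) e^{-2iπ⟨k,x⟩} dx`. -/
def fCoeff (d : ℕ) (g : (Fin d → ℝ) → ℂ) (k : Fin d → ℤ) : ℂ :=
  ∫ x in cube d, g x * (starRingEnd ℂ) (phi d k x)

def box (d M : ℕ) : Finset (Fin d → ℤ) :=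
  Fintype.piFinset fun _ => Finset.Icc (-(M : ℤ)) (M : ℤ)

/-- The Euclidean distance on `ℝ^d`. -/
def euclid (d : ℕ) (x y : Fin d → ℝ) : ℝ := Real.sqrt (∑ i, (x i - y i) ^ 2)

theorem norm_phi (d : ℕ) (k : Fin d → ℤ) (x : Fin d → ℝ) : ‖phi d k x‖ = 1 := by
  have h : Complex.I * (2 * Real.pi) * ∑ i, (k i : ℂ) * (x i : ℂ)
      = ((2 * Real.pi * ∑ i, (k i : ℝ) * x i : ℝ) : ℂ) * Complex.I := by
    push_cast; ring
  rw [phi, h, Complex.norm_exp_ofReal_mul_I]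

theorem continuous_phi (d : ℕ) (k : Fin d → ℤ) : Continuous (phi d k) := by
  unfold phi; fun_prop

theorem phi_mul_conj_phi (d : ℕ) (k l : Fin d → ℤ) (x : Fin d → ℝ) :
    phi d l x * (starRingEnd ℂ) (phi d k x) = phi d (l - k) x := by
  simp only [phi, ← Complex.exp_conj, ← Complex.exp_add]
  congr 1
  simp only [map_mul, map_sum, Complex.conj_I, Complex.conj_ofReal, map_intCast, map_ofNat,
    Pi.sub_apply, Int.cast_sub, sub_mul, Finset.sum_sub_distrib]
  ring

theorem phi_update_add (d : ℕ) (k : Fin d → ℤ) (x : Fin d → ℝ) (j : Fin d) (δ : ℝ) :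
    phi d k (Function.update x j (x j + δ))
      = phi d k x * Complex.exp (Complex.I * (2 * Real.pi * (k j * δ) : ℝ)) := by
  have h : ∑ i, (k i : ℂ) * ((Function.update x j (x j + δ) i : ℝ) : ℂ)
      = ∑ i, (k i : ℂ) * (x i : ℂ) + k j * δ := by
    have : ∀ i, (k i : ℂ) * ((Function.update x j (x j + δ) i : ℝ) : ℂ)
        = (k i : ℂ) * (x i : ℂ) + if i = j then (k j : ℂ) * δ else 0 := by
      intro i
      by_cases hij : i = j
      · subst hij; simp [mul_add]
      · simp [hij]
    simp [this, Finset.sum_add_distrib]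
  rw [phi, phi, ← Complex.exp_add, h]
  congr 1
  push_cast; ring

theorem phi_update_add_one (d : ℕ) (k : Fin d → ℤ) (x : Fin d → ℝ) (j : Fin d) :
    phi d k (Function.update x j (x j + 1)) = phi d k x := by
  rw [phi_update_add]
  have h : Complex.I * (2 * Real.pi * (k j * 1) : ℝ) = k j * (2 * Real.pi * Complex.I) := by
    push_cast; ring
  rw [h, Complex.exp_int_mul_two_pi_mul_I, mul_one]

theorem volume_restrict_cube (d : ℕ) :
    (volume : Measure (Fin d → ℝ)).restrict (cube d)
      = Measure.pi fun _ => (volume : Measure ℝ).restrict (Set.Icc 0 1) := by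
  rw [← Measure.restrict_pi_pi, Set.pi_univ_Icc]
  rfl

instance isProbabilityMeasure_restrict_cube (d : ℕ) :
    IsProbabilityMeasure ((volume : Measure (Fin d → ℝ)).restrict (cube d)) := by
  have : IsProbabilityMeasure ((volume : Measure ℝ).restrict (Set.Icc 0 1)) := ⟨by simp⟩
  rw [volume_restrict_cube]
  infer_instance

theorem setIntegral_exp_int (m : ℤ) :
    ∫ t in Set.Icc (0 : ℝ) 1, Complex.exp (Complex.I * (2 * Real.pi) * (m * (t : ℂ)))
      = if m = 0 then 1 else 0 := by
  rw [integral_Icc_eq_integral_Ioc, ← intervalIntegral.integral_of_le zero_le_one]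
  split_ifs with hm
  · simp [hm]
  · have hc : Complex.I * (2 * Real.pi) * m ≠ 0 := by simp [hm, Real.pi_ne_zero]
    simp only [← mul_assoc (Complex.I * (2 * Real.pi))]
    rw [integral_exp_mul_complex hc]
    have h : Complex.I * (2 * Real.pi) * m * ((1 : ℝ) : ℂ) = m * (2 * Real.pi * Complex.I) := by
      push_cast; ring
    rw [h, Complex.exp_int_mul_two_pi_mul_I]
    simp

theorem setIntegral_phi (d : ℕ) (m : Fin d → ℤ) :
    ∫ x in cube d, phi d m x = if m = 0 then 1 else 0 := by
  simp only [phi, Finset.mul_sum, Complex.exp_sum]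
  rw [volume_restrict_cube, integral_fintype_prod_eq_prod
    (fun i (t : ℝ) => Complex.exp (Complex.I * (2 * Real.pi) * (m i * (t : ℂ))))]
  simp only [setIntegral_exp_int]
  split_ifs with hm
  · simp [hm]
  · obtain ⟨i, hi⟩ := Function.ne_iff.mp hm
    exact Finset.prod_eq_zero (Finset.mem_univ i) (by simpa using hi)

theorem memLp_phi (d : ℕ) (k : Fin d → ℤ) :
    MemLp (phi d k) 2 (volume.restrict (cube d)) :=
  MemLp.of_bound (continuous_phi d k).aestronglyMeasurable 1
    (Filter.Eventually.of_forall fun x => (norm_phi d k x).le)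

theorem inner_memLp_phi (d : ℕ) (k : Fin d → ℤ) {g : (Fin d → ℝ) → ℂ}
    (hg : MemLp g 2 (volume.restrict (cube d))) :
    inner ℂ ((memLp_phi d k).toLp) (hg.toLp) = fCoeff d g k := by
  rw [L2.inner_def, fCoeff]
  refine integral_congr_ae ?_
  filter_upwards [(memLp_phi d k).coeFn_toLp, hg.coeFn_toLp] with x hx hy
  rw [hx, hy, RCLike.inner_apply]

theorem orthonormal_phi (d : ℕ) :
    Orthonormal ℂ fun k : Fin d → ℤ => (memLp_phi d k).toLp := by
  classical
  rw [orthonormal_iff_ite]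
  intro k l
  simp only [inner_memLp_phi, fCoeff, phi_mul_conj_phi, setIntegral_phi, sub_eq_zero, eq_comm]

/-- Bessel's inequality for a uniformly bounded function. -/
theorem sum_sq_norm_fCoeff_le (d : ℕ) {g : (Fin d → ℝ) → ℂ} (hg : Continuous g) {K : ℝ}
    (hK : 0 ≤ K) (hgK : ∀ x, ‖g x‖ ≤ K) (F : Finset (Fin d → ℤ)) :
    ∑ k ∈ F, ‖fCoeff d g k‖ ^ 2 ≤ K ^ 2 := by
  have hmem : MemLp g 2 (volume.restrict (cube d)) :=
    MemLp.of_bound hg.aestronglyMeasurable K (Filter.Eventually.of_forall hgK)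
  have hbessel := (orthonormal_phi d).sum_inner_products_le hmem.toLp (s := F)
  simp only [inner_memLp_phi] at hbessel
  have hnorm : ‖hmem.toLp‖ ≤ K := by
    have h := Lp.norm_le_of_ae_bound (f := hmem.toLp) hK
      (by filter_upwards [hmem.coeFn_toLp] with x hx; rw [hx]; exact hgK x)
    simpa [measureUnivNNReal] using h
  exact hbessel.trans (by gcongr)

/-- The integral over the unit cube of a function that is `1`-periodic in the `j`-th coordinate is
invariant under translations in that coordinate. -/
theorem setIntegral_cube_update_add (d : ℕ) {F : (Fin d → ℝ) → ℂ} (hF : Continuous F) (j : Fin d)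
    (hper : ∀ x, F (Function.update x j (x j + 1)) = F x) (δ : ℝ) :
    ∫ x in cube d, F (Function.update x j (x j + δ)) = ∫ x in cube d, F x := by
  obtain _ | n := d
  · exact j.elim0
  have key : ∀ G : (Fin (n + 1) → ℝ) → ℂ, Continuous G →
      ∫ x in cube (n + 1), G x
        = ∫ y in Set.Icc (0 : Fin n → ℝ) 1, ∫ t in (0 : ℝ)..1, G (j.insertNth t y) := by
    intro G hG
    have hmp := (volume_preserving_piFinSuccAbove (fun _ : Fin (n + 1) => ℝ) j).symm
    have hpre : (MeasurableEquiv.piFinSuccAbove (fun _ : Fin (n + 1) => ℝ) j).symm ⁻¹' cube (n + 1)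
        = Set.Icc (0 : ℝ) 1 ×ˢ Set.Icc (0 : Fin n → ℝ) 1 := by
      ext ⟨t, y⟩
      exact Fin.insertNth_mem_Icc
    have hcont : Continuous fun z : ℝ × (Fin n → ℝ) =>
        G ((MeasurableEquiv.piFinSuccAbove (fun _ : Fin (n + 1) => ℝ) j).symm z) :=
      hG.comp (Continuous.finInsertNth (A := fun _ => ℝ) j continuous_fst continuous_snd)
    rw [← hmp.setIntegral_preimage_emb (MeasurableEquiv.measurableEmbedding _), hpre,
      Measure.volume_eq_prod, ← Measure.prod_restrict, integral_prod_symm]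
    · simp only [intervalIntegral.integral_of_le zero_le_one, ← integral_Icc_eq_integral_Ioc]
      rfl
    · rw [Measure.prod_restrict]
      exact hcont.continuousOn.integrableOn_compact (isCompact_Icc.prod isCompact_Icc)
  rw [key _ hF, key (fun x => F (Function.update x j (x j + δ))) (hF.comp (by fun_prop))]
  refine integral_congr_ae (Filter.Eventually.of_forall fun y => ?_)
  have hp : Function.Periodic (fun t : ℝ => F (j.insertNth t y)) 1 := by
    intro t
    have h := hper (j.insertNth t y)
    rwa [Fin.insertNth_apply_same, Fin.update_insertNth] at h
  simp only [Fin.insertNth_apply_same, Fin.update_insertNth]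
  rw [intervalIntegral.integral_comp_add_right (fun t : ℝ => F (j.insertNth t y)), zero_add,
    add_comm 1 δ, hp.intervalIntegral_add_eq δ 0, zero_add]

theorem fCoeff_update_add_sub (d : ℕ) {g : (Fin d → ℝ) → ℂ} (hg : Continuous g) (j : Fin d)
    (hper : ∀ x, g (Function.update x j (x j + 1)) = g x) (δ : ℝ) (k : Fin d → ℤ) :
    fCoeff d (fun x => g (Function.update x j (x j + δ)) - g x) k
      = (Complex.exp (Complex.I * (2 * Real.pi * (k j * δ) : ℝ)) - 1) * fCoeff d g k := by
  have hcg : Continuous fun x => g x * (starRingEnd ℂ) (phi d k x) :=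
    hg.mul (Complex.continuous_conj.comp (continuous_phi d k))
  have hcomp := setIntegral_cube_update_add d hcg j
    (fun x => by rw [hper, phi_update_add_one]) δ
  have hint : ∀ G : (Fin d → ℝ) → ℂ, Continuous G → IntegrableOn G (cube d) :=
    fun G hG => hG.continuousOn.integrableOn_compact isCompact_Icc
  set E := Complex.exp (Complex.I * (2 * Real.pi * (k j * δ) : ℝ)) with hE
  have hEE : E * (starRingEnd ℂ) E = 1 := by
    rw [Complex.mul_conj, Complex.normSq_eq_norm_sq, hE, mul_comm, Complex.norm_exp_ofReal_mul_I]
    simp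
  have hpt : ∀ x, (g (Function.update x j (x j + δ)) - g x) * (starRingEnd ℂ) (phi d k x)
      = E * (g (Function.update x j (x j + δ)) *
          (starRingEnd ℂ) (phi d k (Function.update x j (x j + δ))))
        - g x * (starRingEnd ℂ) (phi d k x) := by
    intro x
    rw [phi_update_add, ← hE, map_mul]
    linear_combination (- g (Function.update x j (x j + δ)) * (starRingEnd ℂ) (phi d k x)) * hEE
  simp only [fCoeff, hpt]
  have hshift : Continuous fun x => E * (g (Function.update x j (x j + δ)) *
      (starRingEnd ℂ) (phi d k (Function.update x j (x j + δ)))) :=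
    continuous_const.mul (hcg.comp (f := fun x : Fin d → ℝ => Function.update x j (x j + δ)) (by fun_prop))
  rw [integral_sub (hint _ hshift) (hint _ hcg), integral_const_mul, hcomp]
  ring

theorem three_le_sq_norm_exp_sub_one {α : ℝ} (h1 : 2 * Real.pi / 3 ≤ |α|)
    (h2 : |α| ≤ 4 * Real.pi / 3) : 3 ≤ ‖Complex.exp (Complex.I * α) - 1‖ ^ 2 := by
  have hcos : 1 / 2 ≤ Real.cos (Real.pi - |α|) := by
    rw [← Real.cos_abs, ← Real.cos_pi_div_three]
    apply Real.cos_le_cos_of_nonneg_of_le_pi (abs_nonneg _)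
    · linarith [Real.pi_pos]
    · rw [abs_le]; constructor <;> linarith
  rw [Real.cos_pi_sub, Real.cos_abs] at hcos
  rw [← Complex.normSq_eq_norm_sq, Complex.normSq_sub, mul_comm, Complex.normSq_eq_norm_sq,
    Complex.norm_exp_ofReal_mul_I]
  simp only [map_one, mul_one, Complex.exp_ofReal_mul_I_re]
  linarith

theorem euclid_update_add (d : ℕ) (x : Fin d → ℝ) (j : Fin d) (δ : ℝ) :
    euclid d (Function.update x j (x j + δ)) x = |δ| := by
  have h : ∀ i, (Function.update x j (x j + δ) i - x i) ^ 2 = if i = j then δ ^ 2 else 0 := by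
    intro i
    by_cases hij : i = j
    · subst hij; simp
    · simp [hij]
  simp [euclid, h, Real.sqrt_sq_eq_abs]

/-- Energy of a Hölder function on the frequencies whose `j`-th coordinate is of size `N`. -/
theorem sum_sq_norm_fCoeff_dyadic_le (d : ℕ) {s R : ℝ} (hs : 0 < s) (hR : 0 < R)
    {f : (Fin d → ℝ) → ℝ} (hcont : Continuous f)
    (hper : ∀ (x : Fin d → ℝ) (i : Fin d), f (Function.update x i (x i + 1)) = f x)
    (hhold : ∀ x y : Fin d → ℝ, |f x - f y| ≤ R * euclid d x y ^ s)
    (j : Fin d) {N : ℝ} (hN : 0 < N) (F : Finset (Fin d → ℤ))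
    (hF : ∀ k ∈ F, N ≤ |(k j : ℝ)| ∧ |(k j : ℝ)| ≤ 2 * N) :
    ∑ k ∈ F, ‖fCoeff d (fun x => (f x : ℂ)) k‖ ^ 2 ≤ R ^ 2 * N ^ (-(2 * s)) := by
  have hcf : Continuous fun x => (f x : ℂ) := Complex.continuous_ofReal.comp hcont
  have hδ : 0 < 1 / (3 * N) := by positivity
  have hb := sum_sq_norm_fCoeff_le d
    (g := fun x => (f (Function.update x j (x j + 1 / (3 * N))) : ℂ) - f x)
    ((hcf.comp (by fun_prop)).sub hcf) (K := R * (1 / (3 * N)) ^ s) (by positivity)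
    (fun x => by
      rw [← Complex.ofReal_sub, Complex.norm_real, Real.norm_eq_abs]
      simpa only [euclid_update_add, abs_of_pos hδ] using
        hhold (Function.update x j (x j + 1 / (3 * N))) x) F
  have hlow : ∑ k ∈ F, 3 * ‖fCoeff d (fun x => (f x : ℂ)) k‖ ^ 2 ≤ (R * (1 / (3 * N)) ^ s) ^ 2 := by
    refine (Finset.sum_le_sum fun k hk => ?_).trans hb
    rw [fCoeff_update_add_sub d hcf j (fun x => by rw [hper]), norm_mul, mul_pow]
    obtain ⟨hk1, hk2⟩ := hF k hk
    have habs : |2 * Real.pi * (k j * (1 / (3 * N)))| = 2 * Real.pi / 3 * (|(k j : ℝ)| / N) := by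
      rw [abs_mul, abs_mul (k j : ℝ), abs_of_pos Real.two_pi_pos, abs_of_pos hδ]
      field_simp
    have hle : 1 ≤ |(k j : ℝ)| / N := (one_le_div hN).mpr hk1
    have hge : |(k j : ℝ)| / N ≤ 2 := (div_le_iff₀ hN).mpr hk2
    gcongr
    apply three_le_sq_norm_exp_sub_one <;> rw [habs] <;> nlinarith [Real.pi_pos]
  have hpow : (R * (1 / (3 * N)) ^ s) ^ 2 ≤ R ^ 2 * N ^ (-(2 * s)) := by
    have hle : (1 / (3 * N)) ^ s ≤ N ^ (-s) := by
      rw [Real.rpow_neg hN.le, ← Real.inv_rpow hN.le]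
      apply Real.rpow_le_rpow hδ.le _ hs.le
      rw [one_div]
      gcongr
      linarith
    have hsq : N ^ (-(2 * s)) = (N ^ (-s)) ^ 2 := by
      rw [← Real.rpow_natCast, ← Real.rpow_mul hN.le]; congr 1; push_cast; ring
    rw [mul_pow, hsq]
    gcongr
  rw [← Finset.mul_sum] at hlow
  have : 0 ≤ ∑ k ∈ F, ‖fCoeff d (fun x => (f x : ℂ)) k‖ ^ 2 := by positivity
  linarith

theorem exists_dyadic_le {N a : ℝ} (hN : 0 < N) (ha : N ≤ a) :
    ∃ l : ℕ, 2 ^ l * N ≤ a ∧ a ≤ 2 * (2 ^ l * N) := by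
  obtain ⟨l, h1, h2⟩ := exists_nat_pow_near ((one_le_div hN).mpr ha) (one_lt_two)
  rw [le_div_iff₀ hN] at h1
  rw [div_lt_iff₀ hN, pow_succ] at h2
  exact ⟨l, h1, by linarith⟩

theorem exists_natCast_add_one_le_abs {d M : ℕ} {k : Fin d → ℤ} (hk : k ∉ box d M) :
    ∃ j, (M : ℝ) + 1 ≤ |(k j : ℝ)| := by
  simp only [_root_.box, Fintype.mem_piFinset, Finset.mem_Icc, ← abs_le, not_forall, not_le] at hk
  obtain ⟨j, hj⟩ := hk
  exact ⟨j, by exact_mod_cast hj⟩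

theorem sum_sq_norm_fCoeff_tail_le (d : ℕ) (hd : 1 ≤ d) {s R : ℝ} (hs : 0 < s) (hR : 0 < R)
    {f : (Fin d → ℝ) → ℝ} (hcont : Continuous f)
    (hper : ∀ (x : Fin d → ℝ) (i : Fin d), f (Function.update x i (x i + 1)) = f x)
    (hhold : ∀ x y : Fin d → ℝ, |f x - f y| ≤ R * euclid d x y ^ s)
    (M : ℕ) (F : Finset (Fin d → ℤ)) (hF : ∀ k ∈ F, k ∉ box d M) :
    ∑ k ∈ F, ‖fCoeff d (fun x => (f x : ℂ)) k‖ ^ 2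
      ≤ d * (R ^ 2 * ((M : ℝ) + 1) ^ (-(2 * s)) * (1 - (2 : ℝ) ^ (-(2 * s)))⁻¹) := by
  classical
  have hM : (0 : ℝ) < M + 1 := by positivity
  have hcover : ∀ k ∈ F, ∃ p : Fin d × ℕ,
      2 ^ p.2 * ((M : ℝ) + 1) ≤ |(k p.1 : ℝ)| ∧ |(k p.1 : ℝ)| ≤ 2 * (2 ^ p.2 * ((M : ℝ) + 1)) := by
    intro k hk
    obtain ⟨j, hj⟩ := exists_natCast_add_one_le_abs (hF k hk)
    obtain ⟨l, hl⟩ := exists_dyadic_le hM hj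
    exact ⟨(j, l), hl⟩
  have : Nonempty (Fin d) := ⟨⟨0, hd⟩⟩
  choose! p hp using hcover
  have hq0 : (0 : ℝ) ≤ 2 ^ (-(2 * s)) := by positivity
  have hq1 : (2 : ℝ) ^ (-(2 * s)) < 1 :=
    Real.rpow_lt_one_of_one_lt_of_neg one_lt_two (by linarith)
  have hblock : ∀ j : Fin d, ∀ l : ℕ,
      ∑ k ∈ F with p k = (j, l), ‖fCoeff d (fun x => (f x : ℂ)) k‖ ^ 2
        ≤ R ^ 2 * ((M : ℝ) + 1) ^ (-(2 * s)) * ((2 : ℝ) ^ (-(2 * s))) ^ l := by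
    intro j l
    refine (sum_sq_norm_fCoeff_dyadic_le d hs hR hcont hper hhold j
      (N := 2 ^ l * ((M : ℝ) + 1)) (by positivity) _ fun k hk => ?_).trans_eq ?_
    · obtain ⟨hkF, hkp⟩ := Finset.mem_filter.mp hk
      simpa only [hkp] using hp k hkF
    · rw [Real.mul_rpow (by positivity) hM.le, ← Real.rpow_natCast 2 l, ← Real.rpow_mul zero_le_two,
        mul_comm (l : ℝ), Real.rpow_mul zero_le_two, Real.rpow_natCast]
      ring
  calc ∑ k ∈ F, ‖fCoeff d (fun x => (f x : ℂ)) k‖ ^ 2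
      = ∑ q ∈ Finset.univ ×ˢ F.image (fun k => (p k).2),
          ∑ k ∈ F with p k = q, ‖fCoeff d (fun x => (f x : ℂ)) k‖ ^ 2 :=
        (Finset.sum_fiberwise_of_maps_to (g := p) (fun k hk => Finset.mem_product.mpr
          ⟨Finset.mem_univ _, Finset.mem_image_of_mem (fun k => (p k).2) hk⟩) _).symm
    _ ≤ ∑ q ∈ (Finset.univ : Finset (Fin d)) ×ˢ F.image (fun k => (p k).2),
          R ^ 2 * ((M : ℝ) + 1) ^ (-(2 * s)) * ((2 : ℝ) ^ (-(2 * s))) ^ q.2 :=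
        Finset.sum_le_sum fun q _ => hblock q.1 q.2
    _ = d * (R ^ 2 * ((M : ℝ) + 1) ^ (-(2 * s)) *
          ∑ l ∈ F.image (fun k => (p k).2), ((2 : ℝ) ^ (-(2 * s))) ^ l) := by
        rw [Finset.sum_product]
        simp [← Finset.mul_sum]
    _ ≤ _ := by
        rw [← tsum_geometric_of_lt_one hq0 hq1]
        gcongr
        exact (summable_geometric_of_lt_one hq0 hq1).sum_le_tsum _ fun l _ => by positivity

/-- Fourier tail of a periodic Hölder function. If `f : ℝ^d → ℝ` is
continuous, `1`-periodic in each coordinate and `s`-Hölder with constant `R`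
(Euclidean norm), then for every `M ≥ 1`,
`Σ_{k ∉ {-M,…,M}^d} |θ_k(f)|² ≤ C(s) d R² (M+1)^{-2s}` with
`C(s) = 2^{2s} 3^{-s} / (1 - 2^{-2s})`. -/
theorem stmt12 (d : ℕ) (hd : 1 ≤ d) (s : ℝ) (hs0 : 0 < s) (hs1 : s < 1)
    (R : ℝ) (hR : 0 < R) (f : (Fin d → ℝ) → ℝ)
    (hcont : Continuous f)
    (hper : ∀ (x : Fin d → ℝ) (i : Fin d), f (Function.update x i (x i + 1)) = f x)
    (hhold : ∀ x y : Fin d → ℝ, |f x - f y| ≤ R * euclid d x y ^ s)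
    (M : ℕ) (hM : 1 ≤ M) :
    ∑' k : {k : Fin d → ℤ // k ∉ box d M},
        ‖fCoeff d (fun x => (f x : ℂ)) (k : Fin d → ℤ)‖ ^ 2
      ≤ (2 : ℝ) ^ (2 * s) * (3 : ℝ) ^ (-s) / (1 - (2 : ℝ) ^ (-(2 * s))) *
          d * R ^ 2 * ((M : ℝ) + 1) ^ (-(2 * s)) := by
  have hq1 : (2 : ℝ) ^ (-(2 * s)) < 1 :=
    Real.rpow_lt_one_of_one_lt_of_neg one_lt_two (by linarith)
  have hinv : 0 ≤ (1 - (2 : ℝ) ^ (-(2 * s)))⁻¹ := inv_nonneg.mpr (by linarith)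
  have hconst : 1 ≤ (2 : ℝ) ^ (2 * s) * (3 : ℝ) ^ (-s) := by
    rw [Real.rpow_mul zero_le_two, Real.rpow_neg (by norm_num), ← div_eq_mul_inv,
      one_le_div (by positivity)]
    exact Real.rpow_le_rpow (by norm_num) (by norm_num) hs0.le
  have hbound : (d : ℝ) * (R ^ 2 * ((M : ℝ) + 1) ^ (-(2 * s)) * (1 - (2 : ℝ) ^ (-(2 * s)))⁻¹)
      ≤ (2 : ℝ) ^ (2 * s) * (3 : ℝ) ^ (-s) / (1 - (2 : ℝ) ^ (-(2 * s))) *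
          d * R ^ 2 * ((M : ℝ) + 1) ^ (-(2 * s)) := by
    refine (le_mul_of_one_le_left (by positivity) hconst).trans_eq ?_
    rw [div_eq_mul_inv]
    ring
  refine Real.tsum_le_of_sum_le (fun k => by positivity) fun F => ?_
  refine le_trans ?_ hbound
  have h := sum_sq_norm_fCoeff_tail_le d hd hs0 hR hcont hper hhold M
    (F.map (Function.Embedding.subtype _)) (fun k hk => by
      obtain ⟨k', -, rfl⟩ := Finset.mem_map.mp hk
      exact k'.2)
  rwa [Finset.sum_map] at h

end
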